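/- Let f: (X,*,∘) → (Y,*,∘) and f': (X',*,∘) → (Y,*,∘) be surjective homomorphisms of skew braces, and let k: A → X and k': A → X' be injective homomorphisms from an abelian skew brace (A,+,+) onto the kernels f⁻¹(1) and f'⁻¹(1) respectively. Assume the two exact sequences have the same direction, i.e. for all y ∈ Y, a ∈ A and all x ∈ X, x' ∈ X' with f(x) = y = f'(x'): x*k(a)*x^{-*} = k(b) ⟺ x'*k'(a)*x'^{-*} = k'(b); x∘k(a)∘x^{-∘} = k(b) ⟺ x'∘k'(a)∘x'^{-∘} = k'(b); and (k(a)∘x)*x^{-*} = k(b) ⟺ (k'(a)∘x')*x'^{-*} = k'(b). Then the subset {(k(-a), k'(a)) : a ∈ A} is an ideal of the pullback skew brace X×_Y X' = {(x,x') ∈ X×X' : f(x) = f'(x')} (with componentwise laws). -/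

import Mathlib

/-- A group structure on a type `X`, given by explicit data and axioms. -/
structure GroupLaw (X : Type*) where
  mul : X → X → X
  one : X
  inv : X → X
  mul_assoc : ∀ a b c, mul (mul a b) c = mul a (mul b c)
  one_mul : ∀ a, mul one a = a
  mul_one : ∀ a, mul a one = a
  inv_mul : ∀ a, mul (inv a) a = one
  mul_inv : ∀ a, mul a (inv a) = one

/-- The componentwise group law on a product. -/
def GroupLaw.prod {X X' : Type*} (L : GroupLaw X) (L' : GroupLaw X') :
    GroupLaw (X × X') where
  mul p q := (L.mul p.1 q.1, L'.mul p.2 q.2)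
  one := (L.one, L'.one)
  inv p := (L.inv p.1, L'.inv p.2)
  mul_assoc a b c := Prod.ext (L.mul_assoc _ _ _) (L'.mul_assoc _ _ _)
  one_mul a := Prod.ext (L.one_mul _) (L'.one_mul _)
  mul_one a := Prod.ext (L.mul_one _) (L'.mul_one _)
  inv_mul a := Prod.ext (L.inv_mul _) (L'.inv_mul _)
  mul_inv a := Prod.ext (L.mul_inv _) (L'.mul_inv _)

/-- `K` is an ideal of the sub-skew brace `H` of `(G, L₁, L₂)`: `K ⊆ H`, `K` is a
subgroup for both laws, `K` is normal in `(H,∘)`, `K*a = a*K` for all `a ∈ H`, and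
`λ_a(K) ⊆ K` for all `a ∈ H` (where `λ_a(b) = a^{-*}*(a∘b)`). -/
def IsIdealIn {G : Type*} (L₁ L₂ : GroupLaw G) (H K : Set G) : Prop :=
  K ⊆ H ∧ L₁.one ∈ K ∧
  (∀ a ∈ K, ∀ b ∈ K, L₁.mul a b ∈ K) ∧ (∀ a ∈ K, L₁.inv a ∈ K) ∧
  (∀ a ∈ K, ∀ b ∈ K, L₂.mul a b ∈ K) ∧ (∀ a ∈ K, L₂.inv a ∈ K) ∧
  (∀ g ∈ H, ∀ a ∈ K, L₂.mul (L₂.mul g a) (L₂.inv g) ∈ K) ∧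
  (∀ g ∈ H, (fun a => L₁.mul a g) '' K = (fun a => L₁.mul g a) '' K) ∧
  (∀ g ∈ H, ∀ a ∈ K, L₁.mul (L₁.inv g) (L₂.mul g a) ∈ K)

namespace GroupLaw

variable {X Y A : Type*}

/-- The Mathlib group attached to a group law. -/
abbrev toGroup (L : GroupLaw X) : Group X :=
  { mul := L.mul, one := L.one, inv := L.inv, mul_assoc := L.mul_assoc, one_mul := L.one_mul,
    mul_one := L.mul_one, inv_mul_cancel := L.inv_mul }

theorem conj_mul_self (L : GroupLaw X) (g a : X) :
    L.mul (L.mul (L.mul g a) (L.inv g)) g = L.mul g a := by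
  letI := L.toGroup
  exact inv_mul_cancel_right (g * a) g

theorem mul_inv_mul (L : GroupLaw X) (g a : X) :
    L.mul (L.mul a (L.inv g)) g = a := by
  letI := L.toGroup
  exact inv_mul_cancel_right a g

theorem inv_inv' (L : GroupLaw X) (g : X) : L.inv (L.inv g) = g := by
  letI := L.toGroup
  exact inv_inv g

theorem mul_conj_inv (L : GroupLaw X) (g a : X) :
    L.mul g (L.mul (L.mul (L.inv g) a) (L.inv (L.inv g))) = L.mul a g := by
  letI := L.toGroup
  change g * (g⁻¹ * a * g⁻¹⁻¹) = a * g
  group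

theorem lam_aux (L : GroupLaw X) (g a : X) :
    L.mul (L.mul (L.inv g) (L.mul a (L.inv g))) (L.inv (L.inv g)) = L.mul (L.inv g) a := by
  letI := L.toGroup
  change (g⁻¹ * (a * g⁻¹)) * g⁻¹⁻¹ = g⁻¹ * a
  group

theorem mul_right_cancel' (L : GroupLaw X) {a b c : X} (h : L.mul a c = L.mul b c) : a = b := by
  letI := L.toGroup
  exact mul_right_cancel (h : a * c = b * c)

theorem inv_eq_of (L : GroupLaw X) {a b : X} (h : L.mul a b = L.one) : L.inv a = b := by
  letI := L.toGroup
  exact inv_eq_of_mul_eq_one_right (h : a * b = 1)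

theorem one_of_idem (L : GroupLaw X) {a : X} (h : L.mul a a = a) : a = L.one := by
  apply L.mul_right_cancel' (c := a)
  rw [h, L.one_mul]

theorem map_one' (L : GroupLaw X) (M : GroupLaw Y) (f : X → Y)
    (hf : ∀ a b, f (L.mul a b) = M.mul (f a) (f b)) : f L.one = M.one := by
  apply M.one_of_idem
  rw [← hf, L.one_mul]

theorem map_inv' (L : GroupLaw X) (M : GroupLaw Y) (f : X → Y)
    (hf : ∀ a b, f (L.mul a b) = M.mul (f a) (f b)) (x : X) : f (L.inv x) = M.inv (f x) := by
  symm
  apply M.inv_eq_of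
  rw [← hf, L.mul_inv, map_one' L M f hf]

theorem one_eq_one (m c : GroupLaw X)
    (hb : ∀ x y z : X, c.mul x (m.mul y z)
        = m.mul (m.mul (c.mul x y) (m.inv x)) (c.mul x z)) : c.one = m.one := by
  have h := hb c.one m.one m.one
  simp only [c.one_mul, m.one_mul, m.mul_one] at h
  have h2 := m.mul_inv c.one
  rwa [← h, m.mul_one] at h2

variable [AddCommGroup A]

theorem k_zero (L : GroupLaw X) (k : A → X)
    (hk : ∀ a b, k (a + b) = L.mul (k a) (k b)) : k 0 = L.one := by
  apply L.one_of_idem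
  rw [← hk, add_zero]

theorem k_neg (L : GroupLaw X) (k : A → X)
    (hk : ∀ a b, k (a + b) = L.mul (k a) (k b)) (a : A) : k (-a) = L.inv (k a) := by
  symm
  apply L.inv_eq_of
  rw [← hk, add_neg_cancel, k_zero L k hk]

theorem conj_neg (L : GroupLaw X) (k : A → X)
    (hk : ∀ a b, k (a + b) = L.mul (k a) (k b)) (x : X) (a b : A)
    (h : L.mul (L.mul x (k a)) (L.inv x) = k b) :
    L.mul (L.mul x (k (-a))) (L.inv x) = k (-b) := by
  rw [k_neg L k hk, k_neg L k hk, ← h]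
  letI := L.toGroup
  change x * (k a)⁻¹ * x⁻¹ = (x * k a * x⁻¹)⁻¹
  group

theorem conj_exists (L : GroupLaw X) (M : GroupLaw Y) (f : X → Y)
    (hf : ∀ a b, f (L.mul a b) = M.mul (f a) (f b)) (k : A → X)
    (hker : ∀ x, f x = M.one ↔ ∃ a, k a = x) (x : X) (a : A) :
    ∃ b, L.mul (L.mul x (k a)) (L.inv x) = k b := by
  have h : f (L.mul (L.mul x (k a)) (L.inv x)) = M.one := by
    rw [hf, hf, (hker _).2 ⟨a, rfl⟩, M.mul_one, ← hf, L.mul_inv, map_one' L M f hf]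
  obtain ⟨b, hb⟩ := (hker _).1 h
  exact ⟨b, hb.symm⟩

theorem xi_exists (m c : GroupLaw X) (mY cY : GroupLaw Y) (h1 : cY.one = mY.one) (f : X → Y)
    (hfm : ∀ a b, f (m.mul a b) = mY.mul (f a) (f b))
    (hfc : ∀ a b, f (c.mul a b) = cY.mul (f a) (f b)) (k : A → X)
    (hker : ∀ x, f x = mY.one ↔ ∃ a, k a = x) (x : X) (a : A) :
    ∃ b, m.mul (c.mul (k a) x) (m.inv x) = k b := by
  have h : f (m.mul (c.mul (k a) x) (m.inv x)) = mY.one := by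
    rw [hfm, hfc, (hker _).2 ⟨a, rfl⟩, ← h1, cY.one_mul, ← hfm, m.mul_inv,
      map_one' m mY f hfm, h1]
  obtain ⟨b, hb⟩ := (hker _).1 h
  exact ⟨b, hb.symm⟩

theorem xi_neg (m c : GroupLaw X)
    (hb : ∀ x y z : X, c.mul x (m.mul y z)
        = m.mul (m.mul (c.mul x y) (m.inv x)) (c.mul x z))
    (k : A → X) (hinj : Function.Injective k)
    (hkm : ∀ a b, k (a + b) = m.mul (k a) (k b))
    (hkc : ∀ a b, k (a + b) = c.mul (k a) (k b)) (x : X) (a b b' : A)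
    (h : m.mul (c.mul (k a) x) (m.inv x) = k b)
    (h' : m.mul (c.mul (k (-a)) x) (m.inv x) = k b') : b' = -b := by
  have e : c.mul (k a) x = m.mul (k b) x := by rw [← h, m.mul_inv_mul]
  have e' : c.mul (k (-a)) x = m.mul (k b') x := by rw [← h', m.mul_inv_mul]
  have q : c.mul (k (-a)) (c.mul (k a) x) = x := by
    rw [← c.mul_assoc, ← hkc, neg_add_cancel, k_zero c k hkc, c.one_mul]
  rw [e, hb, e', ← hkc, ← k_neg m k hkm, ← hkm, ← m.mul_assoc, ← hkm] at q
  have q2 : k (-a + b + - -a + b') = k 0 := by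
    apply m.mul_right_cancel' (c := x)
    rw [q, k_zero m k hkm, m.one_mul]
  have q3 := hinj q2
  rw [eq_neg_iff_add_eq_zero, ← q3]
  abel

end GroupLaw

/-- Let `f : X → Y`, `f' : X' → Y` be surjective homomorphisms of
skew braces with kernels identified with an abelian skew brace `(A,+,+)` via `k`, `k'`.
If the two exact sequences have the same direction (same `*`- and `∘`-conjugation
actions and same skewing index, read through `k` and `k'`), then
`{(k(-a), k'(a)) : a ∈ A}` is an ideal of the pullback skew brace
`X ×_Y X' = {(x,x') : f x = f' x'}`. -/
theorem stmt19 {X X' Y : Type*} {A : Type*} [AddCommGroup A]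
    (mX cX : GroupLaw X) (mX' cX' : GroupLaw X') (mY cY : GroupLaw Y)
    (hbX : ∀ a b c : X, cX.mul a (mX.mul b c)
        = mX.mul (mX.mul (cX.mul a b) (mX.inv a)) (cX.mul a c))
    (hbX' : ∀ a b c : X', cX'.mul a (mX'.mul b c)
        = mX'.mul (mX'.mul (cX'.mul a b) (mX'.inv a)) (cX'.mul a c))
    (hbY : ∀ a b c : Y, cY.mul a (mY.mul b c)
        = mY.mul (mY.mul (cY.mul a b) (mY.inv a)) (cY.mul a c))
    (f : X → Y) (f' : X' → Y)
    (hf : Function.Surjective f) (hf' : Function.Surjective f')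
    (hfm : ∀ a b, f (mX.mul a b) = mY.mul (f a) (f b))
    (hfc : ∀ a b, f (cX.mul a b) = cY.mul (f a) (f b))
    (hf'm : ∀ a b, f' (mX'.mul a b) = mY.mul (f' a) (f' b))
    (hf'c : ∀ a b, f' (cX'.mul a b) = cY.mul (f' a) (f' b))
    -- `k`, `k'` embed the abelian skew brace `(A,+,+)` onto the kernels
    (k : A → X) (k' : A → X')
    (hk : Function.Injective k) (hk' : Function.Injective k')
    (hkm : ∀ a b, k (a + b) = mX.mul (k a) (k b))
    (hkc : ∀ a b, k (a + b) = cX.mul (k a) (k b))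
    (hk'm : ∀ a b, k' (a + b) = mX'.mul (k' a) (k' b))
    (hk'c : ∀ a b, k' (a + b) = cX'.mul (k' a) (k' b))
    (hkker : ∀ x, f x = mY.one ↔ ∃ a, k a = x)
    (hk'ker : ∀ x', f' x' = mY.one ↔ ∃ a, k' a = x')
    -- the two exact sequences have the same direction:
    (hdirm : ∀ (a b : A) (x : X) (x' : X'), f x = f' x' →
      (mX.mul (mX.mul x (k a)) (mX.inv x) = k b ↔
        mX'.mul (mX'.mul x' (k' a)) (mX'.inv x') = k' b))
    (hdirc : ∀ (a b : A) (x : X) (x' : X'), f x = f' x' →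
      (cX.mul (cX.mul x (k a)) (cX.inv x) = k b ↔
        cX'.mul (cX'.mul x' (k' a)) (cX'.inv x') = k' b))
    (hdirξ : ∀ (a b : A) (x : X) (x' : X'), f x = f' x' →
      (mX.mul (cX.mul (k a) x) (mX.inv x) = k b ↔
        mX'.mul (cX'.mul (k' a) x') (mX'.inv x') = k' b)) :
    IsIdealIn (mX.prod mX') (cX.prod cX')
      {p : X × X' | f p.1 = f' p.2}
      (Set.range fun a : A => (k (-a), k' a)) := by
  have hY1 := GroupLaw.one_eq_one mY cY hbY
  have hX1 := GroupLaw.one_eq_one mX cX hbX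
  have hker_c : ∀ x, f x = cY.one ↔ ∃ a, k a = x := by rw [hY1]; exact hkker
  set P := mX.prod mX' with hP
  set C := cX.prod cX' with hC
  set H : Set (X × X') := {p : X × X' | f p.1 = f' p.2} with hH
  set K : Set (X × X') := Set.range fun a : A => (k (-a), k' a) with hK
  have hinvH : ∀ g ∈ H, P.inv g ∈ H := by
    intro g hg
    change f (mX.inv g.1) = f' (mX'.inv g.2)
    rw [GroupLaw.map_inv' mX mY f hfm, GroupLaw.map_inv' mX' mY f' hf'm, hg]
  have conjm : ∀ g ∈ H, ∀ a ∈ K, P.mul (P.mul g a) (P.inv g) ∈ K := by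
    rintro g hg _ ⟨a, rfl⟩
    obtain ⟨b, hb⟩ := GroupLaw.conj_exists mX mY f hfm k hkker g.1 a
    exact ⟨b, Prod.ext (GroupLaw.conj_neg mX k hkm g.1 a b hb).symm
      ((hdirm a b g.1 g.2 hg).1 hb).symm⟩
  have conjc : ∀ g ∈ H, ∀ a ∈ K, C.mul (C.mul g a) (C.inv g) ∈ K := by
    rintro g hg _ ⟨a, rfl⟩
    obtain ⟨b, hb⟩ := GroupLaw.conj_exists cX cY f hfc k hker_c g.1 a
    exact ⟨b, Prod.ext (GroupLaw.conj_neg cX k hkc g.1 a b hb).symm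
      ((hdirc a b g.1 g.2 hg).1 hb).symm⟩
  have xi : ∀ g ∈ H, ∀ a ∈ K, P.mul (C.mul a g) (P.inv g) ∈ K := by
    rintro g hg _ ⟨a, rfl⟩
    obtain ⟨b, hb⟩ := GroupLaw.xi_exists mX cX mY cY hY1 f hfm hfc k hkker g.1 a
    obtain ⟨b', hb'⟩ := GroupLaw.xi_exists mX cX mY cY hY1 f hfm hfc k hkker g.1 (-a)
    have e := GroupLaw.xi_neg mX cX hbX k hk hkm hkc g.1 a b b' hb hb'
    rw [e] at hb'
    exact ⟨b, Prod.ext hb'.symm ((hdirξ a b g.1 g.2 hg).1 hb).symm⟩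
  refine ⟨?_, ?_, ?_, ?_, ?_, ?_, conjc, ?_, ?_⟩
  · rintro _ ⟨a, rfl⟩
    exact ((hkker _).2 ⟨_, rfl⟩).trans ((hk'ker _).2 ⟨_, rfl⟩).symm
  · refine ⟨0, Prod.ext ?_ (GroupLaw.k_zero mX' k' hk'm)⟩
    change k (-0) = mX.one
    rw [neg_zero, GroupLaw.k_zero mX k hkm]
  · rintro _ ⟨a, rfl⟩ _ ⟨b, rfl⟩
    refine ⟨a + b, Prod.ext ?_ (hk'm a b)⟩
    change k (-(a + b)) = mX.mul (k (-a)) (k (-b))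
    rw [neg_add, hkm]
  · rintro _ ⟨a, rfl⟩
    exact ⟨-a, Prod.ext (GroupLaw.k_neg mX k hkm (-a)) (GroupLaw.k_neg mX' k' hk'm a)⟩
  · rintro _ ⟨a, rfl⟩ _ ⟨b, rfl⟩
    refine ⟨a + b, Prod.ext ?_ (hk'c a b)⟩
    change k (-(a + b)) = cX.mul (k (-a)) (k (-b))
    rw [neg_add, hkc]
  · rintro _ ⟨a, rfl⟩
    exact ⟨-a, Prod.ext (GroupLaw.k_neg cX k hkc (-a)) (GroupLaw.k_neg cX' k' hk'c a)⟩
  · intro g hg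
    apply Set.Subset.antisymm
    · rintro _ ⟨a, ha, rfl⟩
      exact ⟨_, conjm _ (hinvH g hg) a ha, P.mul_conj_inv g a⟩
    · rintro _ ⟨a, ha, rfl⟩
      exact ⟨_, conjm g hg a ha, P.conj_mul_self g a⟩
  · intro g hg a ha
    have h := conjm _ (hinvH g hg) _ (xi g hg _ (conjc g hg a ha))
    rwa [C.conj_mul_self, P.lam_aux] at h
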